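/- There exists a valuation v ∈ L^{IL_p} with v(¬p ∨ ¬¬p) = F for an atom p; hence the weak law of excluded middle ¬p ∨ ¬¬p is not a tautology of the RNmatrix R(M_{IL_p}) = ⟨L^{IL_p}, M_{IL_p}⟩. -/

import Mathlib

/-- Formulas of intuitionistic propositional logic. -/
inductive IForm : Type where
  | atom : ℕ → IForm
  | bot : IForm
  | top : IForm
  | neg : IForm → IForm
  | imp : IForm → IForm → IForm
  | conj : IForm → IForm → IForm
  | disj : IForm → IForm → IForm
deriving DecidableEq

/-- Multifunction for negation in `M_{ILp}`: `¬̃F = {F, T}`, `¬̃T = {F}`.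
(`true` is the value `T`, `false` is `F`.) -/
def INeg : Bool → Set Bool
  | false => Set.univ
  | true => {false}

/-- Multifunction for implication in `M_{ILp}`. -/
def IImp : Bool → Bool → Set Bool
  | false, false => Set.univ
  | false, true => {true}
  | true, false => {false}
  | true, true => {true}

/-- `v ∈ Val(M_{ILp})`. -/
def IIsVal (v : IForm → Bool) : Prop :=
  v IForm.bot = false ∧ v IForm.top = true ∧
  (∀ a, v (IForm.neg a) ∈ INeg (v a)) ∧
  (∀ a b, v (IForm.imp a b) ∈ IImp (v a) (v b)) ∧
  (∀ a b, v (IForm.conj a b) = (v a && v b)) ∧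
  (∀ a b, v (IForm.disj a b) = (v a || v b))

/-- The levels `L_k` of valuations of `M_{ILp}`. -/
def ILev : ℕ → Set (IForm → Bool)
  | 0 => {v | IIsVal v}
  | k + 1 => {v | v ∈ ILev k ∧
      (∀ a b, v a = false → v b = false → v (IForm.imp a b) = false →
        ∃ w ∈ ILev k, w a = true ∧ w b = false ∧ ∀ c, v c = true → w c = true) ∧
      (∀ a, v a = false → v (IForm.neg a) = false →
        ∃ w ∈ ILev k, w a = true ∧ ∀ c, v c = true → w c = true)}

/-- `L^{ILp} = ⋂_k L_k`, the restricted set of valuations of the RNmatrix for `ILp`. -/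
def ILimit : Set (IForm → Bool) := {v | ∀ k, v ∈ ILev k}

/-- Kripke forcing over the accessibility relation `R`, with atoms interpreted by `V`. -/
def IForm.Forces {W : Type*} (R : W → W → Prop) (V : ℕ → W → Prop) : IForm → W → Prop
  | .atom n, w => V n w
  | .bot, _ => False
  | .top, _ => True
  | .neg a, w => ∀ u, R w u → ¬ a.Forces R V u
  | .imp a b, w => ∀ u, R w u → a.Forces R V u → b.Forces R V u
  | .conj a b, w => a.Forces R V w ∧ b.Forces R V w
  | .disj a b, w => a.Forces R V w ∨ b.Forces R V w

section Kripke

variable {W : Type*} {R : W → W → Prop} {V : ℕ → W → Prop}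

theorem IForm.Forces.mono (htrans : ∀ x y z, R x y → R y z → R x z)
    (hV : ∀ n x y, R x y → V n x → V n y) (a : IForm) :
    ∀ {x y : W}, R x y → a.Forces R V x → a.Forces R V y := by
  induction a with
  | atom n => exact fun h => hV n _ _ h
  | bot => exact fun _ h => h
  | top => exact fun _ h => h
  | neg a _ => exact fun h ha u hu => ha u (htrans _ _ _ h hu)
  | imp a b _ _ => exact fun h hab u hu => hab u (htrans _ _ _ h hu)
  | conj a b iha ihb => exact fun h hab => ⟨iha h hab.1, ihb h hab.2⟩
  | disj a b iha ihb => exact fun h hab => hab.imp (iha h) (ihb h)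

open Classical in
/-- The two-valued valuation recording which formulas are forced at the world `w`. -/
noncomputable def forcingValuation (R : W → W → Prop) (V : ℕ → W → Prop) (w : W) (a : IForm) :
    Bool :=
  decide (a.Forces R V w)

@[simp]
theorem forcingValuation_eq_true {w : W} {a : IForm} :
    forcingValuation R V w a = true ↔ a.Forces R V w := by
  simp [forcingValuation]

@[simp]
theorem forcingValuation_eq_false {w : W} {a : IForm} :
    forcingValuation R V w a = false ↔ ¬ a.Forces R V w := by
  simp [forcingValuation]

theorem isVal_forcingValuation (hrefl : ∀ x, R x x) (htrans : ∀ x y z, R x y → R y z → R x z)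
    (hV : ∀ n x y, R x y → V n x → V n y) (w : W) : IIsVal (forcingValuation R V w) := by
  refine ⟨by simp [IForm.Forces], by simp [IForm.Forces], fun a => ?_, fun a b => ?_,
    fun a b => by rw [Bool.eq_iff_iff]; simp [IForm.Forces],
    fun a b => by rw [Bool.eq_iff_iff]; simp [IForm.Forces]⟩
  · cases ha : forcingValuation R V w a
    · trivial
    · rw [forcingValuation_eq_true] at ha
      exact forcingValuation_eq_false.2 fun h => h w (hrefl w) ha
  · cases hb : forcingValuation R V w b
    · cases ha : forcingValuation R V w a
      · trivial
      · rw [forcingValuation_eq_true] at ha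
        rw [forcingValuation_eq_false] at hb
        exact forcingValuation_eq_false.2 fun h => hb (h w (hrefl w) ha)
    · rw [forcingValuation_eq_true] at hb
      have h : forcingValuation R V w (IForm.imp a b) = true :=
        forcingValuation_eq_true.2 fun u hu _ => IForm.Forces.mono htrans hV b hu hb
      rw [h]
      cases forcingValuation R V w a <;> rfl

theorem forcingValuation_mem_ILimit (hrefl : ∀ x, R x x)
    (htrans : ∀ x y z, R x y → R y z → R x z)
    (hV : ∀ n x y, R x y → V n x → V n y) (w : W) : forcingValuation R V w ∈ ILimit := by
  intro k
  induction k generalizing w with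
  | zero => exact isVal_forcingValuation hrefl htrans hV w
  | succ k ih =>
    refine ⟨ih w, fun a b _ _ hab => ?_, fun a _ ha => ?_⟩
    · simp only [forcingValuation_eq_false, IForm.Forces, not_forall] at hab
      obtain ⟨u, hu, ha, hb⟩ := hab
      exact ⟨forcingValuation R V u, ih u, by simpa, by simpa, fun c => by
        simpa using IForm.Forces.mono htrans hV c hu⟩
    · simp only [forcingValuation_eq_false, IForm.Forces, not_forall, not_not] at ha
      obtain ⟨u, hu, ha⟩ := ha
      exact ⟨forcingValuation R V u, ih u, by simpa, fun c => by
        simpa using IForm.Forces.mono htrans hV c hu⟩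

end Kripke

/-- The fork with root `none` and leaves `some true`, `some false`, all atoms being forced exactly
at `some true`, refutes the weak law of excluded middle at its root. -/
theorem exists_mem_ILimit_weak_excluded_middle_eq_false (p : ℕ) :
    ∃ v ∈ ILimit, v (IForm.disj (IForm.neg (IForm.atom p))
        (IForm.neg (IForm.neg (IForm.atom p)))) = false := by
  refine ⟨forcingValuation (fun x y : Option Bool => x = none ∨ x = y)
    (fun _ x => x = some true) none, forcingValuation_mem_ILimit ?_ ?_ ?_ none, ?_⟩
  · exact fun _ => Or.inr rfl
  · rintro x y z (rfl | rfl) h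
    · exact Or.inl rfl
    · exact h
  · rintro _ x y (rfl | rfl) h
    · cases h
    · exact h
  · simp [IForm.Forces]
    exact ⟨some false, by simp⟩

theorem weak_excluded_middle_not_tautology_of_RNmatrix_ILp (p : ℕ) :
    (∃ v ∈ ILimit, v (IForm.disj (IForm.neg (IForm.atom p))
        (IForm.neg (IForm.neg (IForm.atom p)))) = false) ∧
    ¬ (∀ v ∈ ILimit, v (IForm.disj (IForm.neg (IForm.atom p))
        (IForm.neg (IForm.neg (IForm.atom p)))) = true) := by
  obtain ⟨v, hv, h⟩ := exists_mem_ILimit_weak_excluded_middle_eq_false p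
  exact ⟨⟨v, hv, h⟩, fun hall => by simp [hall v hv] at h⟩
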